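/- Let I and J be finite sets, Q : I → J → I → J → ℝ, B, C ∈ ℝ, ĵ ∈ J, and Δ ∈ ℝ. Define the scaled matrix Q̃ by Q̃ i j u v = Q i j u v − Δ if j = ĵ and Q̃ i j u v = Q i j u v otherwise. Then a (B,C)-feasible solution x* minimizes f_Q over the set of (B,C)-feasible solutions if and only if x* minimizes f_{Q̃} over the set of (B,C)-feasible solutions. -/

import Mathlib

/-- A solution `x : I → J → ℝ` is `(B,C)`-feasible if every entry is in `{0,1}`,
every column sum (over `I`) equals `B`, and every row sum (over `J`) equals `C`. -/
def IsFeasible {I J : Type*} [Fintype I] [Fintype J]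
    (B C : ℝ) (x : I → J → ℝ) : Prop :=
  (∀ i j, x i j = 0 ∨ x i j = 1) ∧
  (∀ j, ∑ i, x i j = B) ∧
  (∀ i, ∑ j, x i j = C)

/-- The quadratic objective `f_Q(x) = ∑_{i,j,u,v} x i j * Q i j u v * x u v`. -/
def objective {I J : Type*} [Fintype I] [Fintype J]
    (Q : I → J → I → J → ℝ) (x : I → J → ℝ) : ℝ :=
  ∑ i : I, ∑ j : J, ∑ u : I, ∑ v : J, x i j * Q i j u v * x u v

theorem objective_scaled {I J : Type*} [Fintype I] [Fintype J] [DecidableEq J]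
    (Q : I → J → I → J → ℝ) (B C : ℝ) (jhat : J) (Δ : ℝ)
    (x : I → J → ℝ) (hx : IsFeasible B C x) :
    objective (fun i j u v => if j = jhat then Q i j u v - Δ else Q i j u v) x
      = objective Q x - B * (Δ * ∑ _u : I, C) := by
  obtain ⟨-, hB, hC⟩ := hx
  have h1 : ∀ i j, (∑ u : I, ∑ v : J,
      x i j * (if j = jhat then Q i j u v - Δ else Q i j u v) * x u v)
      = (∑ u : I, ∑ v : J, x i j * Q i j u v * x u v)
        - (if j = jhat then x i j * (Δ * ∑ _u : I, C) else 0) := by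
    intro i j
    split_ifs with h
    · simp only [Finset.mul_sum, ← Finset.sum_sub_distrib]
      refine Finset.sum_congr rfl fun u _ => ?_
      rw [← hC u]
      simp only [Finset.mul_sum, ← Finset.sum_sub_distrib]
      refine Finset.sum_congr rfl fun v _ => ?_
      ring
    · simp
  unfold objective
  simp only [h1, Finset.sum_sub_distrib, Finset.sum_ite_eq', Finset.sum_ite_eq,
    Finset.mem_univ, if_true]
  rw [← Finset.sum_mul, hB]

theorem scaling_preserves_minimizers {I J : Type*} [Fintype I] [Fintype J]
    [DecidableEq J]
    (Q : I → J → I → J → ℝ) (B C : ℝ) (jhat : J) (Δ : ℝ)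
    (xstar : I → J → ℝ) (hxstar : IsFeasible B C xstar) :
    (∀ x : I → J → ℝ, IsFeasible B C x → objective Q xstar ≤ objective Q x)
      ↔ (∀ x : I → J → ℝ, IsFeasible B C x →
          objective (fun i j u v => if j = jhat then Q i j u v - Δ else Q i j u v) xstar
            ≤ objective (fun i j u v => if j = jhat then Q i j u v - Δ else Q i j u v) x) := by
  refine forall_congr' fun x => forall_congr' fun hx => ?_
  rw [objective_scaled Q B C jhat Δ xstar hxstar, objective_scaled Q B C jhat Δ x hx,
    sub_le_sub_iff_right]
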